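/- arXiv:1403.6367 — 5 statements merged into one kernel-verified Lean document; each statement's English description precedes it below -/
import Mathlib

section
/- If VA(v₀, a) holds, 0 ≤ v₀ ≤ v_max, and 0 ≤ τ ≤ T₁ + T₂, then 0 ≤ v₀ + a·τ ≤ v_max. (The safety condition VA suffices to keep the velocity within [0, v_max] under constant acceleration a for up to T₁ + T₂ time units, which is the paper's justification that VA 'is necessary for keeping the velocity always in [0, v_max]'.) -/
def VA (c T₁ T₂ vmax v a : ℝ) : Prop :=
  (v > vmax - c * T₁ - c * T₂ → -c ≤ a ∧ a < 0) ∧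
  (v < c * T₁ + c * T₂ → 0 ≤ a ∧ a ≤ c) ∧
  (c * T₁ + c * T₂ ≤ v ∧ v ≤ vmax - c * T₁ - c * T₂ → -c ≤ a ∧ a ≤ c)

theorem VA_keeps_velocity_safe (c T₁ T₂ vmax v₀ a τ : ℝ)
    (hc : 0 < c) (hT₁ : 0 ≤ T₁) (hT₂ : 0 ≤ T₂)
    (hVA : VA c T₁ T₂ vmax v₀ a)
    (hv₀ : 0 ≤ v₀ ∧ v₀ ≤ vmax)
    (hτ : 0 ≤ τ ∧ τ ≤ T₁ + T₂) :
    0 ≤ v₀ + a * τ ∧ v₀ + a * τ ≤ vmax := by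
  obtain ⟨h_high, h_low, h_mid⟩ := hVA
  obtain ⟨hv_nonneg, hv_le⟩ := hv₀
  obtain ⟨hτ_nonneg, hτ_le⟩ := hτ
  have hcτ : c * τ ≤ c * T₁ + c * T₂ := by
    rw [← mul_add]
    exact mul_le_mul_of_nonneg_left hτ_le hc.le
  constructor
  · rcases lt_or_ge v₀ (c * T₁ + c * T₂) with hv | hv
    · have := mul_nonneg (h_low hv).1 hτ_nonneg
      linarith
    · have ha : -c ≤ a := by
        by_cases h : v₀ > vmax - c * T₁ - c * T₂
        · exact (h_high h).1
        · exact (h_mid ⟨hv, not_lt.mp h⟩).1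
      have := mul_le_mul_of_nonneg_right ha hτ_nonneg
      linarith
  · rcases lt_or_ge (vmax - c * T₁ - c * T₂) v₀ with hv | hv
    · have := mul_nonpos_of_nonpos_of_nonneg (h_high hv).2.le hτ_nonneg
      linarith
    · have ha : a ≤ c := by
        by_cases h : v₀ < c * T₁ + c * T₂
        · exact (h_low h).2
        · exact (h_mid ⟨not_lt.mp h, hv⟩).2
      have := mul_le_mul_of_nonneg_right ha hτ_nonneg
      linarith
end

section
/- Let v : ℝ → ℝ be differentiable with v′(τ) = a for all τ (a a real constant), v(0) = v₀, and suppose VA(v₀, a) and 0 ≤ v₀ ≤ v_max. Then for every τ with 0 ≤ τ ≤ T₁: (a < 0 → v(τ) ≥ c·T₂ + (a·τ + c·T₁) ∧ v(τ) ≤ v_max) and (a ≥ 0 → v(τ) ≤ v_max − c·T₂ + (a·τ − c·T₁) ∧ v(τ) ≥ 0). (The formula Inv₁ is a differential invariant of the continuous evolution ⟨ṡ = v, v̇ = a, ṫ₁ = 1 & t₁ < T₁⟩ with respect to the precondition φ₁ = VA(v, a) ∧ 0 ≤ v ≤ v_max ∧ −c ≤ a ≤ c ∧ t₁ = 0.)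 -/
theorem eq_add_mul_of_hasDerivAt_const {v : ℝ → ℝ} {a : ℝ}
    (h : ∀ τ, HasDerivAt v a τ) (τ : ℝ) : v τ = v 0 + a * τ := by
  have hd : ∀ x, HasDerivAt (fun x => v x - a * x) 0 x := fun x => by
    have := (h x).fun_sub ((hasDerivAt_id' x).const_mul a)
    rwa [mul_one, sub_self] at this
  have := is_const_of_deriv_eq_zero (fun x => (hd x).differentiableAt)
    (fun x => (hd x).deriv) τ 0
  simp only [mul_zero, sub_zero] at this
  linarith

theorem Inv1_is_differential_invariant (c T₁ T₂ vmax v₀ a : ℝ)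
    (v : ℝ → ℝ)
    (hc : 0 < c) (hT₁ : 0 ≤ T₁) (hT₂ : 0 ≤ T₂)
    (hderiv : ∀ τ, HasDerivAt v a τ) (hv0 : v 0 = v₀)
    (hVA : VA c T₁ T₂ vmax v₀ a)
    (hv₀ : 0 ≤ v₀ ∧ v₀ ≤ vmax) :
    ∀ τ, 0 ≤ τ → τ ≤ T₁ →
      (a < 0 → v τ ≥ c * T₂ + (a * τ + c * T₁) ∧ v τ ≤ vmax) ∧
      (a ≥ 0 → v τ ≤ vmax - c * T₂ + (a * τ - c * T₁) ∧ v τ ≥ 0) := by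
  intro τ hτ _
  have hv : v τ = v₀ + a * τ := hv0 ▸ eq_add_mul_of_hasDerivAt_const hderiv τ
  obtain ⟨hhigh, hlow, -⟩ := hVA
  rw [hv]
  refine ⟨fun ha => ?_, fun ha => ?_⟩
  · have hge : c * T₁ + c * T₂ ≤ v₀ := by
      by_contra! hlt
      exact absurd (hlow hlt).1 (not_le.mpr ha)
    have := mul_nonpos_of_nonpos_of_nonneg ha.le hτ
    constructor <;> linarith
  · have hle : v₀ ≤ vmax - c * T₁ - c * T₂ := by
      by_contra! hlt
      exact absurd (hhigh hlt).2 (not_lt.mpr ha)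
    have := mul_nonneg ha hτ
    constructor <;> linarith
end

section
/- Let v : ℝ → ℝ be differentiable with v′(τ) = a for all τ (a a real constant with −c ≤ a ≤ c), v(0) = v₀, and suppose (a < 0 → c·T₂ ≤ v₀ ∧ v₀ ≤ v_max) and (a ≥ 0 → 0 ≤ v₀ ∧ v₀ ≤ v_max − c·T₂). Then for every τ with 0 ≤ τ ≤ T₂: (a < 0 → v(τ) ≥ a·τ + c·T₂ ∧ v(τ) ≤ v_max) and (a ≥ 0 → v(τ) ≤ v_max + (a·τ − c·T₂) ∧ v(τ) ≥ 0). (The formula Inv₂ is a differential invariant of the continuous evolution ⟨ṡ = v, v̇ = a, ṫ₂ = 1 & t₂ < T₂⟩ with respect to the stated precondition.) -/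
theorem Inv2_is_differential_invariant (c T₂ vmax v₀ a : ℝ)
    (v : ℝ → ℝ)
    (hc : 0 < c) (hT₂ : 0 ≤ T₂)
    (ha : -c ≤ a ∧ a ≤ c)
    (hderiv : ∀ τ, HasDerivAt v a τ) (hv0 : v 0 = v₀)
    (hneg : a < 0 → c * T₂ ≤ v₀ ∧ v₀ ≤ vmax)
    (hpos : a ≥ 0 → 0 ≤ v₀ ∧ v₀ ≤ vmax - c * T₂) :
    ∀ τ, 0 ≤ τ → τ ≤ T₂ →
      (a < 0 → v τ ≥ a * τ + c * T₂ ∧ v τ ≤ vmax) ∧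
      (a ≥ 0 → v τ ≤ vmax + (a * τ - c * T₂) ∧ v τ ≥ 0) := by
  intro τ hτ _
  rw [eq_add_mul_of_hasDerivAt_const hderiv τ, hv0]
  refine ⟨fun h => ?_, fun h => ?_⟩
  · obtain ⟨h₁, h₂⟩ := hneg h
    have := mul_nonpos_of_nonpos_of_nonneg h.le hτ
    constructor <;> linarith
  · obtain ⟨h₁, h₂⟩ := hpos h
    have := mul_nonneg h hτ
    constructor <;> linarith
end

section
/- Suppose −c ≤ a ≤ c and 0 ≤ t₂ ≤ T₂, and the invariant Inv₂ holds at (t₂, v), i.e., (a < 0 → v ≥ a·t₂ + c·T₂ ∧ v ≤ v_max) and (a ≥ 0 → v ≤ v_max + (a·t₂ − c·T₂) ∧ v ≥ 0). Then 0 ≤ v ≤ v_max. (The invariant Inv₂ is strong enough for guaranteeing 0 ≤ v ≤ v_max throughout and after the second continuous evolution.) -/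
theorem Inv2_implies_safe (c T₂ vmax v a t₂ : ℝ)
    (hc : 0 < c) (hT₂ : 0 ≤ T₂)
    (ha : -c ≤ a ∧ a ≤ c)
    (ht₂ : 0 ≤ t₂ ∧ t₂ ≤ T₂)
    (hneg : a < 0 → v ≥ a * t₂ + c * T₂ ∧ v ≤ vmax)
    (hpos : a ≥ 0 → v ≤ vmax + (a * t₂ - c * T₂) ∧ v ≥ 0) :
    0 ≤ v ∧ v ≤ vmax := by
  obtain ⟨hca, hac⟩ := ha
  obtain ⟨ht0, htT⟩ := ht₂
  have hcT : 0 ≤ c * (T₂ - t₂) := mul_nonneg hc.le (sub_nonneg.2 htT)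
  rcases lt_or_ge a 0 with h | h
  · obtain ⟨hlow, hup⟩ := hneg h
    have : 0 ≤ (a + c) * t₂ := mul_nonneg (by linarith) ht0
    exact ⟨by linarith, hup⟩
  · obtain ⟨hup, hlow⟩ := hpos h
    have : 0 ≤ (c - a) * t₂ := mul_nonneg (sub_nonneg.2 hac) ht0
    exact ⟨hlow, by linarith⟩
end

section
/- Suppose VA(v₀, a) and 0 ≤ v₀ ≤ v_max, let 0 ≤ τ₁ ≤ T₁ and 0 ≤ τ₂ ≤ T₂, and set v₁ = v₀ + a·(τ₁ + τ₂). Then: (i) for every σ with 0 ≤ σ ≤ τ₁ + τ₂, 0 ≤ v₀ + a·σ ≤ v_max; (ii) 0 ≤ v₁ ≤ v_max; and (iii) for every ρ with 0 ≤ ρ ≤ v₁/c, 0 ≤ v₁ − c·ρ ≤ v_max. (Concrete form of property (F2) for one loop of the train: the velocity remains in the safe range [0, v_max] throughout the two movement phases of durations τ₁ and τ₂ under the VA-validated acceleration a, and also throughout a subsequent emergency brake of the self-control SC; hence the precondition 0 ≤ v ≤ v_max is preserved by one loop of the train process even under denial-of-service by driver and VC.) -/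
/-- A validated acceleration keeps the velocity in the safe range for `T₁ + T₂` time units. -/
lemma VA.velocity_mem_Icc {c T₁ T₂ vmax v a σ : ℝ} (hVA : VA c T₁ T₂ vmax v a) (hc : 0 < c)
    (hv : 0 ≤ v ∧ v ≤ vmax) (hσ : 0 ≤ σ) (hσT : σ ≤ T₁ + T₂) :
    0 ≤ v + a * σ ∧ v + a * σ ≤ vmax := by
  obtain ⟨hhigh, hlow, hmid⟩ := hVA
  have hcσ : c * σ ≤ c * T₁ + c * T₂ := by
    rw [← mul_add]
    exact mul_le_mul_of_nonneg_left hσT hc.le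
  constructor
  · by_cases hl : v < c * T₁ + c * T₂
    · exact add_nonneg hv.1 (mul_nonneg (hlow hl).1 hσ)
    · have ha : -c ≤ a := by
        by_cases hh : v > vmax - c * T₁ - c * T₂
        · exact (hhigh hh).1
        · exact (hmid ⟨not_lt.mp hl, not_lt.mp hh⟩).1
      linarith [mul_le_mul_of_nonneg_right ha hσ]
  · by_cases hh : v > vmax - c * T₁ - c * T₂
    · linarith [mul_nonpos_of_nonpos_of_nonneg (hhigh hh).2.le hσ]
    · have ha : a ≤ c := by
        by_cases hl : v < c * T₁ + c * T₂
        · exact (hlow hl).2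
        · exact (hmid ⟨not_lt.mp hl, not_lt.mp hh⟩).2
      linarith [mul_le_mul_of_nonneg_right ha hσ]

theorem train_one_loop_safe (c T₁ T₂ vmax v₀ a τ₁ τ₂ : ℝ)
    (hc : 0 < c) (hT₁ : 0 ≤ T₁) (hT₂ : 0 ≤ T₂)
    (hVA : VA c T₁ T₂ vmax v₀ a)
    (hv₀ : 0 ≤ v₀ ∧ v₀ ≤ vmax)
    (hτ₁ : 0 ≤ τ₁ ∧ τ₁ ≤ T₁) (hτ₂ : 0 ≤ τ₂ ∧ τ₂ ≤ T₂) :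
    (∀ σ, 0 ≤ σ → σ ≤ τ₁ + τ₂ → 0 ≤ v₀ + a * σ ∧ v₀ + a * σ ≤ vmax) ∧
    (0 ≤ v₀ + a * (τ₁ + τ₂) ∧ v₀ + a * (τ₁ + τ₂) ≤ vmax) ∧
    (∀ ρ, 0 ≤ ρ → ρ ≤ (v₀ + a * (τ₁ + τ₂)) / c →
      0 ≤ v₀ + a * (τ₁ + τ₂) - c * ρ ∧ v₀ + a * (τ₁ + τ₂) - c * ρ ≤ vmax) := by
  have hsafe : ∀ σ, 0 ≤ σ → σ ≤ τ₁ + τ₂ → 0 ≤ v₀ + a * σ ∧ v₀ + a * σ ≤ vmax :=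
    fun σ hσ hστ => hVA.velocity_mem_Icc hc hv₀ hσ (hστ.trans (add_le_add hτ₁.2 hτ₂.2))
  have hend := hsafe (τ₁ + τ₂) (add_nonneg hτ₁.1 hτ₂.1) le_rfl
  refine ⟨hsafe, hend, fun ρ hρ hρv => ⟨?_, ?_⟩⟩
  · rw [le_div_iff₀ hc] at hρv
    linarith
  · linarith [mul_nonneg hc.le hρ, hend.2]
end
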